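/- arXiv:1310.3663 — 3 statements merged into one kernel-verified Lean document; each statement's English description precedes it below -/
import Mathlib

section
/- N₀ is a subgroup of M, and the evaluation pairing induces a well-defined perfect pairing (M/N₀) × A^φ → Fˣ, (c·N₀, β) ↦ c(β): it induces group isomorphisms M/N₀ ≅ Hom(A^φ, Fˣ) and A^φ ≅ Hom(M/N₀, Fˣ). In particular M/N₀ and A^φ are finite abelian groups of the same order (indeed abstractly isomorphic). -/
/-- The automorphism `τ_M` of the character group `M = Hom(A, Fˣ)`, defined by
`(τ_M c) β = (c (τ⁻¹ β)) ^ q`. -/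
def tauM {A F : Type*} [CommGroup A] [Field F] (τ : A ≃* A) (q : ℕ)
    (c : A →* Fˣ) : A →* Fˣ :=
  (c.comp (τ.symm : A ≃* A).toMonoidHom) ^ q

/-- The subgroup `A^φ` of elements fixed by `φ : β ↦ (τ⁻¹ β) ^ q`. -/
def Aphi {A : Type*} [CommGroup A] (τ : A ≃* A) (q : ℕ) : Subgroup A where
  carrier := {β | τ.symm β ^ q = β}
  one_mem' := by simp
  mul_mem' := by
    intro a b ha hb
    simp only [Set.mem_setOf_eq, map_mul, mul_pow] at *
    rw [ha, hb]
  inv_mem' := by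
    intro a ha
    simp only [Set.mem_setOf_eq, map_inv, inv_pow] at *
    rw [ha]

/-- The range of the transpose of `f : G →* H` on characters consists of the characters of `G`
that are trivial on the kernel of `f`. -/
theorem MonoidHom.range_compHom_flip_eq_ker_domRestrictHom {G H : Type*} (M : Type*)
    [CommGroup G] [CommGroup H] [Finite H] [CommMonoid M]
    [HasEnoughRootsOfUnity M (Monoid.exponent H)] (f : G →* H) :
    (MonoidHom.compHom.flip f : (H →* Mˣ) →* (G →* Mˣ)).range =
      (MonoidHom.domRestrictHom f.ker Mˣ).ker := by
  ext c
  rw [MonoidHom.mem_ker, MonoidHom.domRestrictHom_apply, MonoidHom.domRestrict_eq_one_iff]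
  constructor
  · rintro ⟨d, rfl⟩ x hx
    simp [MonoidHom.mem_ker.mp hx]
  · intro hc
    have hc' : f.ker ≤ c.ker := fun x hx ↦ hc x hx
    obtain ⟨d, hd⟩ := MonoidHom.domRestrict_surjective M f.range
      ((QuotientGroup.lift f.ker c hc').comp
        (QuotientGroup.quotientKerEquivRange f).symm.toMonoidHom)
    refine ⟨d, MonoidHom.ext fun x ↦ ?_⟩
    have hx : (QuotientGroup.quotientKerEquivRange f).symm ⟨f x, x, rfl⟩ = QuotientGroup.mk x :=
      (MulEquiv.symm_apply_eq _).mpr rfl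
    have h := DFunLike.congr_fun hd ⟨f x, x, rfl⟩
    simpa [hx] using h

/-- An algebraically closed field of characteristic `p` has enough roots of unity of every order
prime to `p`. -/
theorem IsAlgClosed.hasEnoughRootsOfUnity_of_coprime {p n : ℕ} (hp : p.Prime) (F : Type*) [Field F]
    [IsAlgClosed F] [CharP F p] (hn : n.Coprime p) : HasEnoughRootsOfUnity F n := by
  have : NeZero (n : F) := ⟨fun h ↦ hp.one_lt.ne' <|
    Nat.eq_one_of_dvd_coprimes hn.symm dvd_rfl ((CharP.cast_eq_zero_iff F p n).mp h)⟩
  infer_instance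

/-- `N₀` is a subgroup of `M`, and the evaluation pairing induces a
well-defined perfect pairing `(M/N₀) × A^φ → Fˣ`: it induces group isomorphisms
`M/N₀ ≅ Hom(A^φ, Fˣ)` and `A^φ ≅ Hom(M/N₀, Fˣ)`.  In particular `M/N₀` and `A^φ` are
finite abelian groups of the same order, indeed abstractly isomorphic. -/
theorem stmt8 {p q : ℕ} (hp : p.Prime) (hq : ∃ r : ℕ, q = p ^ r)
    {F : Type*} [Field F] [IsAlgClosed F] [CharP F p]
    {A : Type*} [CommGroup A] [Finite A]
    (hA : Nat.Coprime (Monoid.exponent A) p)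
    (τ : A ≃* A) :
    ∃ N : Subgroup (A →* Fˣ),
      (N : Set (A →* Fˣ)) = Set.range (fun c : A →* Fˣ => c * (tauM τ q c)⁻¹) ∧
      ∃ (e₁ : ((A →* Fˣ) ⧸ N) ≃* ((Aphi τ q) →* Fˣ))
        (e₂ : (Aphi τ q) ≃* (((A →* Fˣ) ⧸ N) →* Fˣ)),
        (∀ (c : A →* Fˣ) (β : Aphi τ q), e₁ (QuotientGroup.mk c) β = c β) ∧
        (∀ (β : Aphi τ q) (c : A →* Fˣ), e₂ β (QuotientGroup.mk c) = c β) ∧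
        Nat.card ((A →* Fˣ) ⧸ N) = Nat.card (Aphi τ q) ∧
        Nonempty (((A →* Fˣ) ⧸ N) ≃* (Aphi τ q)) := by
  have hF : HasEnoughRootsOfUnity F (Monoid.exponent A) :=
    IsAlgClosed.hasEnoughRootsOfUnity_of_coprime hp F hA
  have hF' : HasEnoughRootsOfUnity F (Monoid.exponent (Aphi τ q)) :=
    hF.of_dvd F <| Monoid.exponent_submonoid_dvd (Aphi τ q).toSubmonoid
  let f : A →* A := MonoidHom.id A / τ.symm.toMonoidHom ^ q
  have hf : f.ker = Aphi τ q := by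
    ext x
    change x / τ.symm x ^ q = 1 ↔ τ.symm x ^ q = x
    rw [div_eq_one, eq_comm]
  have hrange := MonoidHom.range_compHom_flip_eq_ker_domRestrictHom F f
  rw [hf] at hrange
  let e₁ : ((A →* Fˣ) ⧸ (MonoidHom.domRestrictHom (Aphi τ q) Fˣ).ker) ≃* (Aphi τ q →* Fˣ) :=
    QuotientGroup.quotientKerEquivOfSurjective _ (MonoidHom.domRestrict_surjective F (Aphi τ q))
  let e : (Aphi τ q →* Fˣ) ≃* Aphi τ q :=
    (CommGroup.monoidHom_mulEquiv_of_hasEnoughRootsOfUnity (Aphi τ q) F).some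
  refine ⟨(MonoidHom.domRestrictHom (Aphi τ q) Fˣ).ker, ?_, e₁,
    (CommGroup.monoidHomMonoidHomEquiv (Aphi τ q) F).symm.trans e₁.symm.monoidHomCongrLeft,
    fun _ _ ↦ rfl, fun _ _ ↦ rfl, Nat.card_congr (e₁.trans e).toEquiv, ⟨e₁.trans e⟩⟩
  rw [← hrange, MonoidHom.coe_range]
  congr 1
  ext c x
  simp [f, tauM, div_eq_mul_inv]
end

section
/- Let G and H be finite groups of the same order, let q ≥ 1 be an integer coprime to that order, let τ_G and τ_H be automorphisms of G and H respectively, and let f: G → H be a group isomorphism such that τ_H⁻¹ ∘ (f ∘ τ_G ∘ f⁻¹) is an inner automorphism of H. Then, writing φ_G(b) = τ_G⁻¹(b^q) and φ_H(c) = τ_H⁻¹(c^q): for every b ∈ G and every n ≥ 1, φ_H^n(f(b)) is conjugate to f(b) in H if and only if φ_G^n(b) is conjugate to b in G; consequently n_{f(b)} = n_b, and N_H(f(b)) = f̄(N_G(b)), where f̄: G^{ab} → H^{ab} is the isomorphism induced by f and N_G, N_H denote the q-norm maps of G and H. -/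
/-- `n_b`: the least `n ≥ 1` such that `φ^[n] b` is conjugate to `b`. -/
noncomputable def nIdx {G : Type*} [Group G] (φ : G → G) (b : G) : ℕ :=
  sInf {n : ℕ | 0 < n ∧ IsConj (φ^[n] b) b}

/-- The `q`-norm `N(b) = ∏_{i=0}^{n_b - 1} π (φ^i b) ∈ G^{ab}`. -/
noncomputable def qNorm {G : Type*} [Group G] (φ : G → G) (b : G) : Abelianization G :=
  ∏ i ∈ Finset.range (nIdx φ b), Abelianization.of (φ^[i] b)

theorem IsConj.mulEquiv_pow {G H : Type*} [Group G] [Group H] (e : G ≃* H) {a b : G}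
    (hab : IsConj a b) (q : ℕ) : IsConj (e (a ^ q)) (e (b ^ q)) := by
  obtain ⟨c, rfl⟩ := isConj_iff.1 hab
  exact isConj_iff.2 ⟨e c, by rw [conj_pow]; simp⟩

theorem isConj_mulEquiv_iff {G H : Type*} [Group G] [Group H] (e : G ≃* H) {a b : G} :
    IsConj (e a) (e b) ↔ IsConj a b :=
  ⟨fun h => by simpa using h.mulEquiv_pow e.symm 1, fun h => by simpa using h.mulEquiv_pow e 1⟩

theorem Abelianization.of_eq_of_isConj {G : Type*} [Group G] {a b : G} (hab : IsConj a b) :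
    Abelianization.of a = Abelianization.of b :=
  isConj_iff_eq.1 (Abelianization.of.map_isConj hab)

/-- If `f` intertwines `φ` and `ψ` up to conjugacy and `ψ` respects conjugacy, then `f`
intertwines their iterates up to conjugacy. -/
theorem isConj_iterate {G H : Type*} [Group H] {φ : G → G} {ψ : H → H} {f : G → H}
    (hψ : ∀ x y, IsConj x y → IsConj (ψ x) (ψ y))
    (hf : ∀ x, IsConj (f (φ x)) (ψ (f x))) (b : G) (n : ℕ) :
    IsConj (f (φ^[n] b)) (ψ^[n] (f b)) := by
  induction n with
  | zero => exact IsConj.refl _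
  | succ n ih =>
    rw [Function.iterate_succ_apply', Function.iterate_succ_apply']
    exact (hf _).trans (hψ _ _ ih)

/-- Let `G`, `H` be finite groups of the same order, `q ≥ 1` coprime to
that order, `τ_G`, `τ_H` automorphisms, and `f : G ≃ H` an isomorphism such that
`τ_H⁻¹ ∘ (f ∘ τ_G ∘ f⁻¹)` is inner.  Then, with `φ_G b = τ_G⁻¹ (b ^ q)` and
`φ_H c = τ_H⁻¹ (c ^ q)`: for every `b ∈ G` and `n ≥ 1`, `φ_H^n (f b)` is conjugate to
`f b` iff `φ_G^n b` is conjugate to `b`; consequently `n_{f b} = n_b` and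
`N_H (f b) = f̄ (N_G b)`. -/
theorem stmt9 {G H : Type*} [Group G] [Finite G] [Group H] [Finite H]
    (hcard : Nat.card G = Nat.card H)
    (q : ℕ) (hq : 1 ≤ q) (hcop : Nat.Coprime q (Nat.card G))
    (τG : G ≃* G) (τH : H ≃* H) (f : G ≃* H)
    (hinner : ∃ h : H, ∀ x : H, τH.symm (f (τG (f.symm x))) = h * x * h⁻¹) :
    (∀ b : G, ∀ n : ℕ, 1 ≤ n →
      (IsConj ((fun c : H => τH.symm (c ^ q))^[n] (f b)) (f b) ↔
        IsConj ((fun b : G => τG.symm (b ^ q))^[n] b) b)) ∧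
    (∀ b : G, nIdx (fun c : H => τH.symm (c ^ q)) (f b) =
      nIdx (fun b : G => τG.symm (b ^ q)) b) ∧
    (∀ b : G, qNorm (fun c : H => τH.symm (c ^ q)) (f b) =
      Abelianization.map f.toMonoidHom (qNorm (fun b : G => τG.symm (b ^ q)) b)) := by
  obtain ⟨h, hh⟩ := hinner
  have key := isConj_iterate (φ := fun b : G => τG.symm (b ^ q))
    (ψ := fun c : H => τH.symm (c ^ q)) (f := f)
    (fun _ _ hxy => hxy.mulEquiv_pow τH.symm q)
    (fun x => isConj_iff.2 ⟨h, by rw [← hh]; simp⟩)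
  have hiff : ∀ (b : G) (n : ℕ),
      IsConj ((fun c : H => τH.symm (c ^ q))^[n] (f b)) (f b) ↔
        IsConj ((fun b : G => τG.symm (b ^ q))^[n] b) b := fun b n =>
    ⟨fun hc => (isConj_mulEquiv_iff f).1 ((key b n).trans hc),
      fun hc => (key b n).symm.trans ((isConj_mulEquiv_iff f).2 hc)⟩
  have hidx : ∀ b : G, nIdx (fun c : H => τH.symm (c ^ q)) (f b) =
      nIdx (fun b : G => τG.symm (b ^ q)) b := fun b => by
    simp only [nIdx, hiff]
  refine ⟨fun b n _ => hiff b n, hidx, fun b => ?_⟩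
  rw [qNorm, qNorm, hidx, map_prod]
  refine Finset.prod_congr rfl fun i _ => ?_
  rw [Abelianization.map_of]
  exact (Abelianization.of_eq_of_isConj (key b i)).symm
end

section
/- Suppose that τ^m is an inner automorphism of G for some integer m ≥ 1 and that gcd(exp(G), q^m − 1) = 1, where exp(G) is the exponent of G. Then the only element β ∈ G^{ab} with φ̄(β) = β (i.e., with τ̄⁻¹(β^q) = β) is the identity: the fixed subgroup (G^{ab})^{φ̄} is trivial. -/
/-- If an endomorphism acts on `β` as the `q`-th power, its `n`-th iterate acts as the
`q ^ n`-th power. -/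
theorem iterate_map_eq_pow_pow {M : Type*} [Monoid M] (f : M →* M) {q : ℕ} {β : M}
    (h : f β = β ^ q) (n : ℕ) : f^[n] β = β ^ q ^ n := by
  induction n with
  | zero => simp
  | succ n ih => rw [Function.iterate_succ_apply', ih, map_pow, h, ← pow_mul, pow_succ']

theorem Abelianization.iterate_map_of {G : Type*} [Group G] (f : G →* G) (n : ℕ) (x : G) :
    (Abelianization.map f)^[n] (Abelianization.of x) = Abelianization.of (f^[n] x) :=
  (Function.Semiconj.iterate_right (f := Abelianization.of)
    (fun y => (Abelianization.map_of f y).symm) n x).symm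

/-- Suppose `τ^m` is an inner automorphism of `G` for some `m ≥ 1` and
`gcd (exp G, q^m - 1) = 1`.  Then the only `β ∈ G^{ab}` with `φ̄ β = β` (i.e. with
`τ̄⁻¹ (β ^ q) = β`, equivalently `β ^ q = τ̄ β`) is the identity: the fixed subgroup
`(G^{ab})^{φ̄}` is trivial. -/
theorem stmt11 {G : Type*} [Group G] [Finite G]
    (q : ℕ) (hq : 1 ≤ q) (hcop : Nat.Coprime q (Nat.card G))
    (τ : G ≃* G) (m : ℕ) (hm : 1 ≤ m)
    (hτ : ∃ g : G, ∀ x : G, (⇑τ)^[m] x = g * x * g⁻¹)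
    (hexp : Nat.Coprime (Monoid.exponent G) (q ^ m - 1)) :
    ∀ β : Abelianization G, β ^ q = Abelianization.map τ.toMonoidHom β → β = 1 := by
  intro β hβ
  obtain ⟨g, hg⟩ := hτ
  have hfix : β ^ q ^ m = β := by
    rw [← iterate_map_eq_pow_pow _ hβ.symm m]
    obtain ⟨x, rfl⟩ := QuotientGroup.mk_surjective β
    exact (Abelianization.iterate_map_of τ.toMonoidHom m x).trans <|
      (congrArg Abelianization.of (hg x)).trans <| by
        simp only [map_mul, map_inv, mul_inv_cancel_comm]; rfl
  have hpow : β ^ (q ^ m - 1) = 1 := by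
    refine mul_right_cancel (b := β) ?_
    rw [pow_sub_one_mul (pow_pos hq m).ne', hfix, one_mul]
  have hexp_pow : β ^ Monoid.exponent G = 1 := by
    obtain ⟨x, rfl⟩ := QuotientGroup.mk_surjective β
    exact (map_pow Abelianization.of x _).symm.trans <| by
      rw [Monoid.pow_exponent_eq_one, map_one]
  rw [← orderOf_eq_one_iff]
  exact Nat.eq_one_of_dvd_coprimes hexp (orderOf_dvd_of_pow_eq_one hexp_pow)
    (orderOf_dvd_of_pow_eq_one hpow)
end
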